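/- arXiv:2001.04924 — 2 statements merged into one kernel-verified Lean document; each statement's English description precedes it below -/
import Mathlib

section
/- Let R be a commutative ring and I ⊆ R an ideal with I² = 0. Let M and N be R-modules, let p : M → N be a surjective R-linear map, and let σ : N → M be an R-linear map such that p(σ(x)) − x ∈ I·N for every x ∈ N. Then there exists an R-linear map σ′ : N → M such that p ∘ σ′ = id_N and σ′(x) − σ(x) ∈ I·M for every x ∈ N. -/
/-- A linear map sends `I·M` into `I·N`. -/
theorem LinearMap.map_mem_ideal_smul_top {R M N : Type*} [CommRing R] [AddCommGroup M]
    [Module R M] [AddCommGroup N] [Module R N] (f : M →ₗ[R] N) {I : Ideal R} {x : M}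
    (hx : x ∈ I • (⊤ : Submodule R M)) : f x ∈ I • (⊤ : Submodule R N) := by
  have h := Submodule.mem_map_of_mem (f := f) hx
  rw [Submodule.map_smul''] at h
  exact Submodule.smul_mono le_rfl le_top h

/-- If `I² = 0`, an endomorphism with image in `I·N` squares to zero. -/
theorem LinearMap.apply_apply_eq_zero_of_mem_ideal_smul_top {R N : Type*} [CommRing R]
    [AddCommGroup N] [Module R N] {I : Ideal R} (hI : I ^ 2 = ⊥) (f : N →ₗ[R] N)
    (hf : ∀ x, f x ∈ I • (⊤ : Submodule R N)) (x : N) : f (f x) = 0 := by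
  have h := Submodule.mem_map_of_mem (f := f) (hf x)
  rw [Submodule.map_smul''] at h
  have hle : (⊤ : Submodule R N).map f ≤ I • ⊤ := by
    rintro _ ⟨y, -, rfl⟩
    exact hf y
  have hz := Submodule.smul_mono le_rfl hle h
  rwa [← Submodule.mul_smul, ← pow_two, hI, Submodule.bot_smul, Submodule.mem_bot] at hz

/-- Square-zero lifting of splittings.  Let `R` be a commutative ring and `I ⊆ R` an ideal
with `I² = 0`.  Let `p : M → N` be a surjective `R`-linear map and `σ : N → M` an `R`-linear
map with `p (σ x) − x ∈ I·N` for all `x`.  Then there is an `R`-linear `σ' : N → M` with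
`p ∘ σ' = id` and `σ' x − σ x ∈ I·M` for all `x`. -/
theorem exists_splitting_of_squareZero (R : Type*) [CommRing R] (I : Ideal R)
    (hI : I ^ 2 = ⊥) (M N : Type*) [AddCommGroup M] [Module R M] [AddCommGroup N]
    [Module R N] (p : M →ₗ[R] N) (hp : Function.Surjective p) (σ : N →ₗ[R] M)
    (hσ : ∀ x : N, p (σ x) - x ∈ I • (⊤ : Submodule R N)) :
    ∃ σ' : N →ₗ[R] M, p ∘ₗ σ' = LinearMap.id ∧
      ∀ x : N, σ' x - σ x ∈ I • (⊤ : Submodule R M) := by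
  have hsq := LinearMap.apply_apply_eq_zero_of_mem_ideal_smul_top hI
    (p ∘ₗ σ - LinearMap.id) (by simpa using hσ)
  refine ⟨σ - σ ∘ₗ (p ∘ₗ σ - LinearMap.id), ?_, fun x => ?_⟩
  · ext x
    have h := hsq x
    simp only [LinearMap.sub_apply, LinearMap.comp_apply, LinearMap.id_apply, map_sub] at h ⊢
    rw [← sub_eq_zero, ← neg_eq_zero, ← h]
    abel
  · have h := neg_mem (σ.map_mem_ideal_smul_top (hσ x))
    simpa using h
end

section
/- Let k be a field, let p be a prime number, let A be a finite-dimensional associative unital k-algebra, and let r be a nonnegative rational number. For a field extension K of k let Mod_{A,r}(K) denote the set of isomorphism classes of finitely generated projective (A ⊗_k K)-modules P of rank r, meaning there exist positive integers d, m with r = m/d and P^{⊕d} ≅ (A ⊗_k K)^{⊕m}; this defines a functor Mod_{A,r} from field extensions of k to sets. For x ∈ Mod_{A,r}(L), say a subextension is a p-field of definition if there are embeddings of extensions K ↪ K′ and L ↪ K′ with K′/L finite of degree prime to p and an element x′ ∈ Mod_{A,r}(K) having the same image as x in Mod_{A,r}(K′); define ed_p(x) as the infimum of trdeg_k K over all such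 K, and ed_p(Mod_{A,r}) as the supremum of ed_p(x) over all field extensions L/k and all x ∈ Mod_{A,r}(L). Then for any finite field extension l/k of degree prime to p, the essential p-dimension of the functor Mod_{A,r} on field extensions of k equals the essential p-dimension of the functor Mod_{A⊗_k l, r} on field extensions of l (with transcendence degrees taken over k and over l respectively). -/
open TensorProduct

attribute [local instance] Algebra.TensorProduct.rightAlgebra

universe u

/-- A field extension of `k`, bundled. -/
structure FieldExt (k : Type u) [Field k] : Type (u + 1) where
  carrier : Type u
  [field : Field carrier]
  [alg : Algebra k carrier]

attribute [instance] FieldExt.field FieldExt.alg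

/-- A (left) module over a (possibly noncommutative) ring `B`, bundled. -/
structure ModuleOver (B : Type u) [Ring B] : Type (u + 1) where
  carrier : Type u
  [acg : AddCommGroup carrier]
  [mod : Module B carrier]

attribute [instance] ModuleOver.acg ModuleOver.mod

/-- `P` is a finitely generated projective `B`-module of rank `r`: it is projective and
there are positive integers `d`, `m` with `r = m/d` and `P^{⊕d} ≅ B^{⊕m}`. -/
def IsProjOfRank {B : Type u} [Ring B] (r : ℚ) (P : ModuleOver B) : Prop :=
  Module.Projective B P.carrier ∧
    ∃ d m : ℕ, 0 < d ∧ 0 < m ∧ r = (m : ℚ) / (d : ℚ) ∧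
      Nonempty ((Fin d → P.carrier) ≃ₗ[B] (Fin m → B))

/-- `Z`, together with the `φ`-semilinear map `f : P → Z`, is the base change of the
`B`-module `P` along the ring homomorphism `φ : B → D`; this is expressed by the universal
property of base change. -/
def IsBaseChangeAlong {B D : Type u} [Ring B] [Ring D] (φ : B →+* D)
    (P : ModuleOver B) (Z : ModuleOver D) (f : P.carrier →+ Z.carrier) : Prop :=
  (∀ (b : B) (x : P.carrier), f (b • x) = φ b • f x) ∧
    ∀ (W : ModuleOver D) (g : P.carrier →+ W.carrier),
      (∀ (b : B) (x : P.carrier), g (b • x) = φ b • g x) →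
      ∃! h : Z.carrier →ₗ[D] W.carrier, ∀ x, h (f x) = g x

/-- Given field extensions `K`, `L`, `K'` of `k` with embeddings `iK : K ↪ K'` and
`iL : L ↪ K'`, the class of the `A ⊗[k] K`-module `P` and the class of the
`A ⊗[k] L`-module `Q` have the same image in `Mod_{A,r}(K')`: there is a module `Z` over
`A ⊗[k] K'` which is simultaneously the base change of `P` along `K ↪ K'` and of `Q` along
`L ↪ K'`. -/
def SameImage (k : Type u) [Field k] (A : Type u) [Ring A] [Algebra k A]
    (K L K' : FieldExt k) (iK : K.carrier →ₐ[k] K'.carrier)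
    (iL : L.carrier →ₐ[k] K'.carrier)
    (P : ModuleOver (A ⊗[k] K.carrier)) (Q : ModuleOver (A ⊗[k] L.carrier)) : Prop :=
  ∃ (Z : ModuleOver (A ⊗[k] K'.carrier)) (f : P.carrier →+ Z.carrier)
      (g : Q.carrier →+ Z.carrier),
    IsBaseChangeAlong (Algebra.TensorProduct.map (AlgHom.id k A) iK).toRingHom P Z f ∧
    IsBaseChangeAlong (Algebra.TensorProduct.map (AlgHom.id k A) iL).toRingHom Q Z g

/-- The transcendence degree of a commutative `k`-algebra `K`: the supremum of the
cardinalities of algebraically independent subsets. -/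
noncomputable def trdeg (k K : Type u) [CommRing k] [CommRing K] [Algebra k K] :
    Cardinal.{u} :=
  ⨆ s : { s : Set K // AlgebraicIndependent k ((↑) : s → K) }, Cardinal.mk s

/-- The essential `p`-dimension of the class of the projective `A ⊗[k] L`-module `Q` of
rank `r` in the functor `Mod_{A,r}`: the infimum of `trdeg_k K` over all `p`-fields of
definition `K` of `Q`, i.e. over all field extensions `K/k` for which there are embeddings
`K ↪ K'`, `L ↪ K'` with `K'/L` finite of degree prime to `p` and a projective
`A ⊗[k] K`-module `P` of rank `r` whose image in `Mod_{A,r}(K')` coincides with that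
of `Q`. -/
noncomputable def edpOfElt (k : Type u) [Field k] (A : Type u) [Ring A] [Algebra k A]
    (r : ℚ) (p : ℕ) (L : FieldExt k) (Q : ModuleOver (A ⊗[k] L.carrier)) : Cardinal.{u} :=
  sInf { n : Cardinal.{u} |
    ∃ (K K' : FieldExt k) (iK : K.carrier →ₐ[k] K'.carrier)
      (iL : L.carrier →ₐ[k] K'.carrier),
      (letI : Algebra L.carrier K'.carrier := iL.toRingHom.toAlgebra
       FiniteDimensional L.carrier K'.carrier ∧
         ¬ p ∣ Module.finrank L.carrier K'.carrier) ∧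
      (∃ P : ModuleOver (A ⊗[k] K.carrier),
        IsProjOfRank r P ∧ SameImage k A K L K' iK iL P Q) ∧
      trdeg k K.carrier = n }

/-- The essential `p`-dimension of the functor `Mod_{A,r}` of isomorphism classes of
projective modules of rank `r` over `A ⊗[k] —`, on field extensions of `k`: the supremum
over all field extensions `L/k` and all projective `A ⊗[k] L`-modules `Q` of rank `r` of
the essential `p`-dimension of the class of `Q`. -/
noncomputable def edpFunctor (k : Type u) [Field k] (A : Type u) [Ring A] [Algebra k A]
    (r : ℚ) (p : ℕ) : Cardinal.{u} :=
  ⨆ (L : FieldExt k) (Q : ModuleOver (A ⊗[k] L.carrier)) (_ : IsProjOfRank r Q),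
    edpOfElt k A r p L Q

section BaseChange

variable {B D E : Type u} [Ring B] [Ring D] [Ring E]

lemma IsBaseChangeAlong.hom_ext {φ : B →+* D} {P : ModuleOver B} {Z : ModuleOver D}
    {f : P.carrier →+ Z.carrier} (hf : IsBaseChangeAlong φ P Z f) {W : ModuleOver D}
    {h₁ h₂ : Z.carrier →ₗ[D] W.carrier} (h : ∀ x, h₁ (f x) = h₂ (f x)) : h₁ = h₂ :=
  (hf.2 W (h₂.toAddMonoidHom.comp f) fun b x => by simp [hf.1]).unique h fun _ => rfl

lemma isBaseChangeAlong_id (P : ModuleOver B) :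
    IsBaseChangeAlong (RingHom.id B) P P (AddMonoidHom.id P.carrier) :=
  ⟨fun _ _ => rfl, fun _ g hg =>
    ⟨{ g with map_smul' := hg }, fun _ => rfl, fun _ hh => LinearMap.ext hh⟩⟩

/-- The module `P` regarded as a `B`-module along `φ : B →+* D`. -/
abbrev ModuleOver.restrict (φ : B →+* D) (P : ModuleOver D) : ModuleOver B :=
  letI := Module.compHom P.carrier φ
  ⟨P.carrier⟩

lemma IsBaseChangeAlong.comp {φ : B →+* D} {ψ : D →+* E} {P : ModuleOver B}
    {Z : ModuleOver D} {Y : ModuleOver E} {f : P.carrier →+ Z.carrier}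
    {g : Z.carrier →+ Y.carrier} (hf : IsBaseChangeAlong φ P Z f)
    (hg : IsBaseChangeAlong ψ Z Y g) :
    IsBaseChangeAlong (ψ.comp φ) P Y (g.comp f) := by
  refine ⟨fun b x => by simp [hf.1, hg.1], fun W u hu => ?_⟩
  obtain ⟨v, hv, -⟩ := hf.2 (W.restrict ψ) u hu
  obtain ⟨w, hw, -⟩ := hg.2 W v.toAddMonoidHom fun d z => v.map_smul d z
  refine ⟨w, fun x => (hw (f x)).trans (hv x), fun w' hw' => hg.hom_ext fun z => ?_⟩
  rw [hw]
  let v' : Z.carrier →ₗ[D] (W.restrict ψ).carrier :=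
    { w'.toAddMonoidHom.comp g with
      map_smul' := fun d z => by
        change w' (g (d • z)) = ψ d • w' (g z)
        rw [hg.1, map_smul] }
  exact DFunLike.congr_fun
    (hf.hom_ext (W := W.restrict ψ) (h₁ := v') (h₂ := v) fun x => (hw' x).trans (hv x).symm) z

/-- If `Z` and `Y` are base changes of `P` along `φ` and `ψ ∘ φ`, then `Y` is a base change of
`Z` along `ψ`. -/
lemma IsBaseChangeAlong.exists_of_comp {φ : B →+* D} {ψ : D →+* E} {P : ModuleOver B}
    {Z : ModuleOver D} {Y : ModuleOver E} {f : P.carrier →+ Z.carrier}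
    {u : P.carrier →+ Y.carrier} (hf : IsBaseChangeAlong φ P Z f)
    (hu : IsBaseChangeAlong (ψ.comp φ) P Y u) :
    ∃ g : Z.carrier →+ Y.carrier, IsBaseChangeAlong ψ Z Y g := by
  obtain ⟨v, hv, -⟩ := hf.2 (Y.restrict ψ) u hu.1
  refine ⟨v.toAddMonoidHom, fun d z => v.map_smul d z, fun W t ht => ?_⟩
  obtain ⟨w, hw, hw'⟩ := hu.2 W (t.comp f) fun b x => by simp [hf.1, ht]
  refine ⟨w, fun z => ?_, fun w' h => hw' w' fun x => ?_⟩
  · let t₁ : Z.carrier →ₗ[D] (W.restrict ψ).carrier :=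
      { w.toAddMonoidHom.comp v.toAddMonoidHom with
        map_smul' := fun d z => by
          change w (v (d • z)) = ψ d • w (v z)
          rw [map_smul]
          exact map_smul w (ψ d) (v z) }
    let t₂ : Z.carrier →ₗ[D] (W.restrict ψ).carrier := { t with map_smul' := ht }
    refine DFunLike.congr_fun
      (hf.hom_ext (W := W.restrict ψ) (h₁ := t₁) (h₂ := t₂) fun x => ?_) z
    exact (congrArg w (hv x)).trans (hw x)
  · exact (congrArg w' (hv x)).symm.trans (h (f x))

lemma exists_isBaseChangeAlong (φ : B →+* D) (P : ModuleOver B) :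
    ∃ (Z : ModuleOver D) (f : P.carrier →+ Z.carrier), IsBaseChangeAlong φ P Z f := by
  let N : Submodule D (D ⊗[ℤ] P.carrier) :=
    Submodule.span D {t | ∃ (b : B) (x : P.carrier), t = 1 ⊗ₜ (b • x) - φ b ⊗ₜ x}
  let f : P.carrier →+ (D ⊗[ℤ] P.carrier) ⧸ N :=
    N.mkQ.toAddMonoidHom.comp (TensorProduct.mk ℤ D P.carrier 1).toAddMonoidHom
  refine ⟨⟨(D ⊗[ℤ] P.carrier) ⧸ N⟩, f, fun b x => ?_, fun W g hg => ?_⟩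
  · change N.mkQ (1 ⊗ₜ (b • x)) = φ b • N.mkQ (1 ⊗ₜ x)
    rw [← map_smul, TensorProduct.smul_tmul', smul_eq_mul, mul_one]
    exact (Submodule.Quotient.eq N).2 (Submodule.subset_span ⟨b, x, rfl⟩)
  · let G : D ⊗[ℤ] P.carrier →ₗ[D] W.carrier :=
      AlgebraTensorModule.lift
        { toFun := fun d => d • g.toIntLinearMap
          map_add' := fun a b => add_smul a b _
          map_smul' := fun a b => mul_smul a b _ }
    have hG : ∀ d x, G (d ⊗ₜ x) = d • g x := fun _ _ => rfl
    have hN : N ≤ LinearMap.ker G := by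
      rw [Submodule.span_le]
      rintro _ ⟨b, x, rfl⟩
      simp [hG, hg]
    refine ⟨N.liftQ G hN, fun x => ?_, fun h hh => ?_⟩
    · exact (hG 1 x).trans (one_smul D _)
    · refine Submodule.linearMap_qext N (AlgebraTensorModule.ext fun d x => ?_)
      have : (d ⊗ₜ x : D ⊗[ℤ] P.carrier) = d • (1 ⊗ₜ x) := by
        rw [TensorProduct.smul_tmul', smul_eq_mul, mul_one]
      rw [this, map_smul, map_smul]
      congr 1
      exact (hh x).trans ((hG 1 x).trans (one_smul D _)).symm

/-- The direct sum of `n` copies of a module. -/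
abbrev ModuleOver.pi (n : ℕ) (P : ModuleOver B) : ModuleOver B := ⟨Fin n → P.carrier⟩

/-- A ring as a left module over itself. -/
abbrev ModuleOver.self (B : Type u) [Ring B] : ModuleOver B := ⟨B⟩

lemma isBaseChangeAlong_self (φ : B →+* D) :
    IsBaseChangeAlong φ (ModuleOver.self B) (ModuleOver.self D) φ.toAddMonoidHom := by
  refine ⟨fun b x => map_mul φ b x, fun W g hg =>
    ⟨LinearMap.toSpanSingleton D W.carrier (g (1 : B)), fun b => ?_, fun h hh => ?_⟩⟩
  · exact (hg b (1 : B)).symm.trans (congrArg g (mul_one b))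
  · refine LinearMap.ext_ring ?_
    have := hh (1 : B)
    simp at this ⊢
    exact this

lemma IsBaseChangeAlong.pi {φ : B →+* D} {P : ModuleOver B} {Z : ModuleOver D}
    {f : P.carrier →+ Z.carrier} (hf : IsBaseChangeAlong φ P Z f) (n : ℕ) :
    IsBaseChangeAlong φ (P.pi n) (Z.pi n) (f.compLeft (Fin n)) := by
  refine ⟨fun b x => funext fun i => hf.1 b (x i), fun W g hg => ?_⟩
  have hs (i : Fin n) (b : B) (x : P.carrier) :
      g.comp (AddMonoidHom.single (fun _ : Fin n => P.carrier) i) (b • x) =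
        φ b • g.comp (AddMonoidHom.single (fun _ : Fin n => P.carrier) i) x := by
    rw [AddMonoidHom.comp_apply, AddMonoidHom.comp_apply, ← hg]
    exact congrArg g ((LinearMap.single B (fun _ : Fin n => P.carrier) i).map_smul b x)
  choose h hh hu using fun i => hf.2 W _ (hs i)
  have hsingle (i : Fin n) (x : P.carrier) :
      (f.compLeft (Fin n)) (Pi.single i x) = Pi.single i (f x) :=
    funext fun j => Pi.apply_single (fun _ => f) (fun _ => map_zero f) i x j
  refine ⟨LinearMap.lsum D _ ℕ h, fun x => ?_, fun h' hh' => ?_⟩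
  · simp only [LinearMap.lsum_apply, LinearMap.sum_apply, LinearMap.comp_apply]
    conv_rhs => rw [← Finset.univ_sum_single x, map_sum]
    exact Finset.sum_congr rfl fun i _ => hh i (x i)
  · refine LinearMap.pi_ext' fun i => hf.hom_ext fun x => ?_
    have := hh' (Pi.single i x)
    rw [hsingle] at this
    simpa [LinearMap.lsum_apply, hh, Pi.single_apply, apply_ite] using this

lemma IsBaseChangeAlong.nonempty_equiv {φ : B →+* D} {P P' : ModuleOver B}
    {Z Z' : ModuleOver D} {f : P.carrier →+ Z.carrier} {f' : P'.carrier →+ Z'.carrier}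
    (hf : IsBaseChangeAlong φ P Z f) (hf' : IsBaseChangeAlong φ P' Z' f')
    (e : P.carrier ≃ₗ[B] P'.carrier) : Nonempty (Z.carrier ≃ₗ[D] Z'.carrier) := by
  obtain ⟨u, hu, -⟩ := hf.2 Z' (f'.comp e.toAddEquiv.toAddMonoidHom) fun b x => by simp [hf'.1]
  obtain ⟨v, hv, -⟩ := hf'.2 Z (f.comp e.symm.toAddEquiv.toAddMonoidHom)
    fun b x => by simp [hf.1]
  exact ⟨.ofLinearMap u v (hf'.hom_ext fun x => by simp [hu, hv])
    (hf.hom_ext fun x => by simp [hu, hv])⟩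

lemma IsBaseChangeAlong.isProjOfRank {φ : B →+* D} {P : ModuleOver B} {Z : ModuleOver D}
    {f : P.carrier →+ Z.carrier} (hf : IsBaseChangeAlong φ P Z f) {r : ℚ}
    (hP : IsProjOfRank r P) : IsProjOfRank r Z := by
  obtain ⟨-, d, m, hd, hm, hr, ⟨e⟩⟩ := hP
  obtain ⟨e'⟩ := (hf.pi d).nonempty_equiv ((isBaseChangeAlong_self φ).pi m) e
  have : Module.Projective D (Fin d → Z.carrier) := .of_equiv e'.symm
  exact ⟨.of_split (LinearMap.single D (fun _ : Fin d => Z.carrier) ⟨0, hd⟩)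
    (LinearMap.proj ⟨0, hd⟩) (by ext; simp), d, m, hd, hm, hr, ⟨e'⟩⟩

end BaseChange

section ScalarChange

variable (k A l : Type u) [Field k] [Ring A] [Algebra k A] [Field l] [Algebra k l]

/-- The canonical homomorphism `A ⊗[k] K → (A ⊗[k] l) ⊗[l] K` for a tower `k ⊆ l ⊆ K`. -/
noncomputable def tensorTowerHom (K : Type u) [Field K] [Algebra k K] [Algebra l K]
    [IsScalarTower k l K] : A ⊗[k] K →ₐ[k] (A ⊗[k] l) ⊗[l] K :=
  Algebra.TensorProduct.lift
    (Algebra.TensorProduct.includeLeft.comp Algebra.TensorProduct.includeLeft)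
    (Algebra.TensorProduct.includeRight.restrictScalars k)
    fun a x => by simp [commute_iff_eq]

variable {k A l} in
lemma tensorTowerHom_tmul {K : Type u} [Field K] [Algebra k K] [Algebra l K]
    [IsScalarTower k l K] (a : A) (x : K) :
    tensorTowerHom k A l K (a ⊗ₜ x) = (a ⊗ₜ 1) ⊗ₜ x := by
  change ((a ⊗ₜ 1) ⊗ₜ 1 : (A ⊗[k] l) ⊗[l] K) * 1 ⊗ₜ x = _
  simp

/-- The inverse of `tensorTowerHom`. -/
noncomputable def tensorTowerInv (K : Type u) [Field K] [Algebra k K] [Algebra l K]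
    [IsScalarTower k l K] : (A ⊗[k] l) ⊗[l] K →+* A ⊗[k] K :=
  letI : Algebra l (A ⊗[k] K) := Algebra.compHom (A ⊗[k] K) (algebraMap l K)
  let i : A ⊗[k] l →ₐ[l] A ⊗[k] K :=
    { Algebra.TensorProduct.map (AlgHom.id k A) (IsScalarTower.toAlgHom k l K) with
      commutes' := fun _ => rfl }
  let j : K →ₐ[l] A ⊗[k] K :=
    { (Algebra.TensorProduct.includeRight : K →ₐ[k] A ⊗[k] K) with
      commutes' := fun _ => rfl }
  (Algebra.TensorProduct.lift i j fun a x => by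
    induction a with
    | zero => exact (map_zero i).symm ▸ Commute.zero_left _
    | add a b ha hb => exact (map_add i a b).symm ▸ ha.add_left hb
    | tmul a c =>
      change (a ⊗ₜ algebraMap l K c : A ⊗[k] K) * 1 ⊗ₜ x = 1 ⊗ₜ x * a ⊗ₜ algebraMap l K c
      simp [mul_comm]).toRingHom

variable {k A l} in
lemma tensorTowerInv_tmul {K : Type u} [Field K] [Algebra k K] [Algebra l K]
    [IsScalarTower k l K] (a : A) (c : l) (x : K) :
    tensorTowerInv k A l K ((a ⊗ₜ c) ⊗ₜ x) = a ⊗ₜ (algebraMap l K c * x) := by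
  change (a ⊗ₜ algebraMap l K c : A ⊗[k] K) * 1 ⊗ₜ x = _
  simp

lemma tensorTowerInv_comp_hom (K : Type u) [Field K] [Algebra k K] [Algebra l K]
    [IsScalarTower k l K] :
    (tensorTowerInv k A l K).comp (tensorTowerHom k A l K).toRingHom = RingHom.id _ := by
  refine RingHom.ext fun t => ?_
  induction t with
  | zero => simp
  | add a b ha hb => rw [map_add, ha, hb, map_add]
  | tmul a x =>
    change tensorTowerInv k A l K (tensorTowerHom k A l K (a ⊗ₜ x)) = a ⊗ₜ x
    rw [tensorTowerHom_tmul, tensorTowerInv_tmul, map_one, one_mul]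

lemma tensorTowerHom_comp_inv (K : Type u) [Field K] [Algebra k K] [Algebra l K]
    [IsScalarTower k l K] :
    (tensorTowerHom k A l K).toRingHom.comp (tensorTowerInv k A l K) = RingHom.id _ := by
  refine RingHom.ext fun t => ?_
  induction t with
  | zero => simp
  | add a b ha hb => rw [map_add, ha, hb, map_add]
  | tmul a x =>
    change tensorTowerHom k A l K (tensorTowerInv k A l K (a ⊗ₜ x)) = a ⊗ₜ x
    induction a with
    | zero => simp
    | add a b ha hb => rw [add_tmul, map_add, map_add, ha, hb]
    | tmul a c =>
      rw [tensorTowerInv_tmul, tensorTowerHom_tmul, ← Algebra.smul_def, tmul_smul, smul_tmul',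
        Algebra.smul_def]
      congr 1
      change (1 ⊗ₜ c) * (a ⊗ₜ 1) = (a ⊗ₜ c : A ⊗[k] l)
      simp

lemma tensorTowerHom_natural {K K' : Type u} [Field K] [Algebra k K] [Algebra l K]
    [IsScalarTower k l K] [Field K'] [Algebra k K'] [Algebra l K'] [IsScalarTower k l K']
    (i : K →ₐ[k] K') (i' : K →ₐ[l] K') (h : ∀ x, i x = i' x) :
    (tensorTowerHom k A l K').toRingHom.comp
        (Algebra.TensorProduct.map (AlgHom.id k A) i).toRingHom =
      (Algebra.TensorProduct.map (AlgHom.id l (A ⊗[k] l)) i').toRingHom.comp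
        (tensorTowerHom k A l K).toRingHom := by
  refine RingHom.ext fun t => ?_
  induction t with
  | zero => simp
  | add a b ha hb => rw [map_add, ha, hb, map_add]
  | tmul a x =>
    change tensorTowerHom k A l K' (a ⊗ₜ i x) =
      Algebra.TensorProduct.map (AlgHom.id l (A ⊗[k] l)) i' (tensorTowerHom k A l K (a ⊗ₜ x))
    rw [tensorTowerHom_tmul, tensorTowerHom_tmul, h]
    rfl

lemma tensorTowerInv_natural {K K' : Type u} [Field K] [Algebra k K] [Algebra l K]
    [IsScalarTower k l K] [Field K'] [Algebra k K'] [Algebra l K'] [IsScalarTower k l K']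
    (i : K →ₐ[k] K') (i' : K →ₐ[l] K') (h : ∀ x, i x = i' x) :
    (tensorTowerInv k A l K').comp
        (Algebra.TensorProduct.map (AlgHom.id l (A ⊗[k] l)) i').toRingHom =
      (Algebra.TensorProduct.map (AlgHom.id k A) i).toRingHom.comp (tensorTowerInv k A l K) := by
  have := congrArg
    (fun f => ((tensorTowerInv k A l K').comp f).comp (tensorTowerInv k A l K))
    (tensorTowerHom_natural k A l i i' h)
  simp only [RingHom.comp_assoc, tensorTowerHom_comp_inv] at this
  simp only [← RingHom.comp_assoc, tensorTowerInv_comp_hom] at this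
  simpa using this.symm

end ScalarChange

section Fields

lemma trdeg_eq_of_isAlgebraic_bot (k l K : Type u) [Field k] [Field l] [Field K] [Algebra k l]
    [Algebra k K] [Algebra l K] [IsScalarTower k l K] [Algebra.IsAlgebraic k l] :
    trdeg k K = trdeg l K := by
  have := trdeg_add_eq k l (A := K)
  rw [trdeg_eq_zero (R := k) (A := l), zero_add] at this
  exact this.symm

lemma trdeg_eq_of_isAlgebraic_top (k K E : Type u) [Field k] [Field K] [Field E] [Algebra k K]
    [Algebra k E] [Algebra K E] [IsScalarTower k K E] [Algebra.IsAlgebraic K E] :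
    trdeg k K = trdeg k E := by
  have := trdeg_add_eq k K (A := E)
  rw [trdeg_eq_zero (R := K) (A := E), add_zero] at this
  exact this

/-- A finite-dimensional commutative algebra of dimension prime to `p` has a residue field of
degree prime to `p`. -/
lemma exists_prime_not_dvd_finrank_quotient (L R : Type u) [Field L] [CommRing R] [Algebra L R]
    [FiniteDimensional L R] (p : ℕ) (h : ¬ p ∣ Module.finrank L R) :
    ∃ I : PrimeSpectrum R, ¬ p ∣ Module.finrank L (R ⧸ I.1) := by
  contrapose! h
  have : IsNoetherianRing R := IsNoetherianRing.of_finite L R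
  exact IsNoetherianRing.induction_on_isQuotientEquivQuotientPrime R (M := R) inferInstance
    (motive := fun N _ _ _ =>
      ∀ [Module L N] [IsScalarTower L R N], p ∣ Module.finrank L N)
    (fun N _ _ _ _ _ _ => by
      rw [Module.finrank_zero_of_subsingleton]
      exact dvd_zero p)
    (fun N _ _ _ I e _ _ => (e.restrictScalars L).finrank_eq ▸ h I)
    (fun N₁ _ _ _ N₂ _ _ _ N₃ _ _ _ f g hf hg hfg h₁ h₃ _ _ => by
      let := Module.compHom N₁ (algebraMap L R)
      let := Module.compHom N₃ (algebraMap L R)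
      have : IsScalarTower L R N₁ := .of_algebraMap_smul fun _ _ => rfl
      have : IsScalarTower L R N₃ := .of_algebraMap_smul fun _ _ => rfl
      have : FiniteDimensional L N₂ := Module.Finite.trans R N₂
      have hker : LinearMap.ker (g.restrictScalars L) = LinearMap.range (f.restrictScalars L) :=
        LinearMap.exact_iff.1 hfg
      rw [← (g.restrictScalars L).finrank_range_add_finrank_ker, hker,
        LinearMap.finrank_range_of_inj (f := f.restrictScalars L) hf,
        LinearMap.range_eq_top_of_surjective (g.restrictScalars L) hg, finrank_top]
      exact dvd_add h₃ h₁)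

/-- A finite extension `l / k` of degree prime to `p` can be embedded, over any extension
`L / k`, in a finite extension of `L` of degree prime to `p`. -/
lemma exists_compositum_not_dvd_finrank (k l L : Type u) [Field k] [Field l] [Field L]
    [Algebra k l] [Algebra k L] [FiniteDimensional k l] (p : ℕ)
    (hl : ¬ p ∣ Module.finrank k l) :
    ∃ (M : Type u) (_ : Field M) (_ : Algebra k M) (_ : Algebra l M) (_ : Algebra L M),
      IsScalarTower k l M ∧ IsScalarTower k L M ∧ FiniteDimensional L M ∧
        ¬ p ∣ Module.finrank L M := by
  rw [← Module.finrank_baseChange (R := L)] at hl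
  obtain ⟨I, hI⟩ := exists_prime_not_dvd_finrank_quotient L (L ⊗[k] l) p hl
  have : IsArtinianRing (L ⊗[k] l) := IsArtinianRing.of_finite L _
  have : I.1.IsMaximal := inferInstance
  let := Ideal.Quotient.field I.1
  refine ⟨(L ⊗[k] l) ⧸ I.1, inferInstance, inferInstance, inferInstance, inferInstance,
    inferInstance, inferInstance, inferInstance, hI⟩

end Fields

section EssentialDimension

variable {k : Type u} [Field k] {A : Type u} [Ring A] [Algebra k A] {r : ℚ} {p : ℕ}

/-- Every field `L` is a `p`-field of definition of each class over `L`. -/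
lemma exists_field_of_definition_self (hp : p.Prime) (L : FieldExt k)
    {Q : ModuleOver (A ⊗[k] L.carrier)}
    (hQ : IsProjOfRank r Q) :
    ∃ (K K' : FieldExt k) (iK : K.carrier →ₐ[k] K'.carrier)
      (iL : L.carrier →ₐ[k] K'.carrier),
      (letI : Algebra L.carrier K'.carrier := iL.toRingHom.toAlgebra
       FiniteDimensional L.carrier K'.carrier ∧
         ¬ p ∣ Module.finrank L.carrier K'.carrier) ∧
      (∃ P : ModuleOver (A ⊗[k] K.carrier),
        IsProjOfRank r P ∧ SameImage k A K L K' iK iL P Q) ∧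
      trdeg k K.carrier = trdeg k L.carrier := by
  have hid : IsBaseChangeAlong
      (Algebra.TensorProduct.map (AlgHom.id k A) (AlgHom.id k L.carrier)).toRingHom Q Q
      (AddMonoidHom.id Q.carrier) := by
    rw [Algebra.TensorProduct.map_id]
    exact isBaseChangeAlong_id Q
  refine ⟨L, L, AlgHom.id k _, AlgHom.id k _, ⟨?_, ?_⟩, ⟨Q, hQ, Q, _, _, hid, hid⟩, rfl⟩
  · exact Module.Finite.self L.carrier
  · exact fun h => hp.one_lt.ne' (Nat.dvd_one.1 ((Module.finrank_self L.carrier) ▸ h))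

lemma edpOfElt_le (hp : p.Prime) (L : FieldExt k) {Q : ModuleOver (A ⊗[k] L.carrier)}
    (hQ : IsProjOfRank r Q) : edpOfElt k A r p L Q ≤ trdeg k L.carrier :=
  csInf_le' (exists_field_of_definition_self hp L hQ)

variable {l : Type u} [Field l] [Algebra k l] [FiniteDimensional k l]

/-- If `Q` over `(A ⊗[k] l) ⊗[l] L` corresponds to `Q₀` over `A ⊗[k] L`, then a `p`-field of
definition `K` of `Q₀` gives the `p`-field of definition `K · l` of `Q`. -/
lemma edpOfElt_tensor_le (hp : p.Prime) (L : Type u) [Field L] [Algebra k L] [Algebra l L]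
    [IsScalarTower k l L] {Q : ModuleOver ((A ⊗[k] l) ⊗[l] L)} {Q₀ : ModuleOver (A ⊗[k] L)}
    (hQ₀ : IsProjOfRank r Q₀) {q : Q.carrier →+ Q₀.carrier}
    (hq : IsBaseChangeAlong (tensorTowerInv k A l L) Q Q₀ q) :
    edpOfElt l (A ⊗[k] l) r p ⟨L⟩ Q ≤ edpOfElt k A r p ⟨L⟩ Q₀ := by
  refine le_csInf ⟨_, exists_field_of_definition_self hp ⟨L⟩ hQ₀⟩ ?_
  rintro _ ⟨⟨K⟩, ⟨K'⟩, iK, iL, hfin, ⟨P, hP, Z, f, g, hf, hg⟩, rfl⟩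
  dsimp only at iK iL hfin P Z f g hf hg ⊢
  let : Algebra l K' := (iL.toRingHom.comp (algebraMap l L)).toAlgebra
  have : IsScalarTower k l K' := .of_algebraMap_eq fun c => by
    change _ = iL (algebraMap l L (algebraMap k l c))
    rw [← IsScalarTower.algebraMap_apply, iL.commutes]
  let iL' : L →ₐ[l] K' := { iL with commutes' := fun _ => rfl }
  let : Algebra K K' := iK.toRingHom.toAlgebra
  have : IsScalarTower k K K' := .of_algebraMap_eq fun c => (iK.commutes c).symm
  let E : IntermediateField K K' := IntermediateField.adjoin K (Set.range (algebraMap l K'))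
  have hE : Algebra.IsAlgebraic K E := IntermediateField.isAlgebraic_adjoin <| by
    rintro _ ⟨c, rfl⟩
    exact ((Algebra.IsIntegral.isIntegral (R := k) c).map
      (IsScalarTower.toAlgHom k l K')).tower_top
  let : Algebra l E := ((algebraMap l K').codRestrict E.toSubfield fun c =>
    IntermediateField.subset_adjoin K _ ⟨c, rfl⟩).toAlgebra
  have : IsScalarTower k l E := .of_algebraMap_eq fun c =>
    Subtype.ext (IsScalarTower.algebraMap_apply k l K' c)
  let iE : E →ₐ[l] K' := { E.val with commutes' := fun _ => rfl }
  let α : A ⊗[k] K →+* (A ⊗[k] l) ⊗[l] E := (tensorTowerHom k A l E).toRingHom.comp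
    (Algebra.TensorProduct.map (AlgHom.id k A) (IsScalarTower.toAlgHom k K E)).toRingHom
  obtain ⟨P₁, u, hu⟩ := exists_isBaseChangeAlong α P
  obtain ⟨Z₁, v, hv⟩ := exists_isBaseChangeAlong (tensorTowerHom k A l K').toRingHom Z
  have hPZ := hf.comp hv
  have hQZ := (hq.comp hg).comp hv
  have e₁ : (tensorTowerHom k A l K').toRingHom.comp
      (Algebra.TensorProduct.map (AlgHom.id k A) iK).toRingHom =
      (Algebra.TensorProduct.map (AlgHom.id l (A ⊗[k] l)) iE).toRingHom.comp α := by
    rw [← RingHom.comp_assoc, ← tensorTowerHom_natural k A l (iE.restrictScalars k) iE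
      fun _ => rfl, RingHom.comp_assoc]
    congr 1
    refine RingHom.ext fun t => ?_
    exact DFunLike.congr_fun (f := Algebra.TensorProduct.map (AlgHom.id k A) iK)
      (g := (Algebra.TensorProduct.map (AlgHom.id k A) (iE.restrictScalars k)).comp
        (Algebra.TensorProduct.map (AlgHom.id k A) (IsScalarTower.toAlgHom k K E)))
      (Algebra.TensorProduct.ext' fun _ _ => rfl) t
  have e₂ : (tensorTowerHom k A l K').toRingHom.comp
      ((Algebra.TensorProduct.map (AlgHom.id k A) iL).toRingHom.comp
        (tensorTowerInv k A l L)) =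
      (Algebra.TensorProduct.map (AlgHom.id l (A ⊗[k] l)) iL').toRingHom := by
    rw [← RingHom.comp_assoc, tensorTowerHom_natural k A l iL iL' fun _ => rfl,
      RingHom.comp_assoc, tensorTowerHom_comp_inv, RingHom.comp_id]
  rw [e₁] at hPZ
  rw [e₂] at hQZ
  obtain ⟨w, hw⟩ := hu.exists_of_comp hPZ
  rw [trdeg_eq_of_isAlgebraic_top k K E, trdeg_eq_of_isAlgebraic_bot k l E]
  exact csInf_le' ⟨⟨E⟩, ⟨K'⟩, iE, iL', hfin, ⟨P₁, hu.isProjOfRank hP, Z₁, w, _, hw, hQZ⟩, rfl⟩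

/-- If `Q'` is the base change of `Q` to an extension `L'` of `L` containing `l` and of degree
prime to `p` over `L`, then every `p`-field of definition of `Q'` is one of `Q`. -/
lemma edpOfElt_le_tensor (hp : p.Prime) (L L' : Type u) [Field L] [Algebra k L] [Field L']
    [Algebra k L'] [Algebra l L'] [Algebra L L'] [IsScalarTower k l L'] [IsScalarTower k L L']
    [FiniteDimensional L L'] (hL' : ¬ p ∣ Module.finrank L L')
    {Q : ModuleOver (A ⊗[k] L)} {Q' : ModuleOver ((A ⊗[k] l) ⊗[l] L')}
    (hQ' : IsProjOfRank r Q') {q : Q.carrier →+ Q'.carrier}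
    (hq : IsBaseChangeAlong ((tensorTowerHom k A l L').toRingHom.comp
      (Algebra.TensorProduct.map (AlgHom.id k A) (IsScalarTower.toAlgHom k L L')).toRingHom)
      Q Q' q) :
    edpOfElt k A r p ⟨L⟩ Q ≤ edpOfElt l (A ⊗[k] l) r p ⟨L'⟩ Q' := by
  refine le_csInf ⟨_, exists_field_of_definition_self hp ⟨L'⟩ hQ'⟩ ?_
  rintro _ ⟨⟨K⟩, ⟨K'⟩, iK, iL, ⟨hfin, hdvd⟩, ⟨P, hP, Z, f, g, hf, hg⟩, rfl⟩
  dsimp only at iK iL hfin hdvd P Z f g hf hg ⊢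
  let : Algebra k K := Algebra.compHom K (algebraMap k l)
  let : Algebra k K' := Algebra.compHom K' (algebraMap k l)
  have : IsScalarTower k l K := .of_algebraMap_eq fun _ => rfl
  have : IsScalarTower k l K' := .of_algebraMap_eq fun _ => rfl
  obtain ⟨P₀, u, hu⟩ := exists_isBaseChangeAlong (tensorTowerInv k A l K) P
  obtain ⟨Z₀, v, hv⟩ := exists_isBaseChangeAlong (tensorTowerInv k A l K') Z
  let iL₀ : L →ₐ[k] K' := (iL.restrictScalars k).comp (IsScalarTower.toAlgHom k L L')
  have hPZ := hf.comp hv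
  have hQZ := (hq.comp hg).comp hv
  have e₂ : (tensorTowerInv k A l K').comp
      ((Algebra.TensorProduct.map (AlgHom.id l (A ⊗[k] l)) iL).toRingHom.comp
        ((tensorTowerHom k A l L').toRingHom.comp
          (Algebra.TensorProduct.map (AlgHom.id k A)
            (IsScalarTower.toAlgHom k L L')).toRingHom)) =
      (Algebra.TensorProduct.map (AlgHom.id k A) iL₀).toRingHom := by
    rw [← RingHom.comp_assoc, tensorTowerInv_natural k A l (iL.restrictScalars k) iL
      fun _ => rfl, ← RingHom.comp_assoc,
      RingHom.comp_assoc (tensorTowerHom k A l L').toRingHom,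
      tensorTowerInv_comp_hom, RingHom.comp_id]
    refine RingHom.ext fun t => ?_
    exact DFunLike.congr_fun
      (f := (Algebra.TensorProduct.map (AlgHom.id k A) (iL.restrictScalars k)).comp
        (Algebra.TensorProduct.map (AlgHom.id k A) (IsScalarTower.toAlgHom k L L')))
      (g := Algebra.TensorProduct.map (AlgHom.id k A) iL₀)
      (Algebra.TensorProduct.ext' fun _ _ => rfl) t
  rw [tensorTowerInv_natural k A l (iK.restrictScalars k) iK fun _ => rfl] at hPZ
  rw [e₂] at hQZ
  obtain ⟨w, hw⟩ := hu.exists_of_comp hPZ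
  rw [← trdeg_eq_of_isAlgebraic_bot k l K]
  refine csInf_le' ⟨⟨K⟩, ⟨K'⟩, iK.restrictScalars k, iL₀, ?_,
    ⟨P₀, hu.isProjOfRank hP, Z₀, w, _, hw, hQZ⟩, rfl⟩
  let : Algebra L' K' := iL.toRingHom.toAlgebra
  let : Algebra L K' := iL₀.toRingHom.toAlgebra
  have : IsScalarTower L L' K' := .of_algebraMap_eq fun _ => rfl
  refine ⟨Module.Finite.trans L' K', fun h => ?_⟩
  rw [← Module.finrank_mul_finrank L L' K', hp.dvd_mul] at h
  exact h.elim hL' hdvd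

end EssentialDimension

/-- No boundedness is needed: mutually cofinal families have the same upper bounds. -/
lemma Cardinal.iSup_eq_iSup_of_forall_exists_le {ι ι' : Type*} {F : ι → Cardinal.{u}}
    {G : ι' → Cardinal.{u}} (h : ∀ i, ∃ j, F i ≤ G j) (h' : ∀ j, ∃ i, G j ≤ F i) :
    ⨆ i, F i = ⨆ j, G j := by
  have hub : upperBounds (Set.range F) = upperBounds (Set.range G) := by
    ext b
    simp only [mem_upperBounds, Set.forall_mem_range]
    exact ⟨fun hb j => (h' j).elim fun i hi => hi.trans (hb i),
      fun hb i => (h i).elim fun j hj => hj.trans (hb j)⟩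
  by_cases hF : BddAbove (Set.range F)
  · have hG : BddAbove (Set.range G) := by rwa [BddAbove, ← hub]
    exact le_antisymm (ciSup_le' fun i => (h i).elim fun j hj => hj.trans (le_ciSup hG j))
      (ciSup_le' fun j => (h' j).elim fun i hi => hi.trans (le_ciSup hF i))
  · have hG : ¬ BddAbove (Set.range G) := by rwa [BddAbove, ← hub]
    rw [ciSup_of_not_bddAbove hF, ciSup_of_not_bddAbove hG]

lemma edpOfElt_le_iSup {k : Type u} [Field k] {A : Type u} [Ring A] [Algebra k A] {r : ℚ}
    {p : ℕ} (hp : p.Prime) (L : FieldExt k) {Q : ModuleOver (A ⊗[k] L.carrier)}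
    (hQ : IsProjOfRank r Q) :
    edpOfElt k A r p L Q ≤
      ⨆ (Q : ModuleOver (A ⊗[k] L.carrier)) (_ : IsProjOfRank r Q), edpOfElt k A r p L Q := by
  refine le_ciSup_of_le ⟨trdeg k L.carrier, ?_⟩ Q (by rw [ciSup_pos hQ])
  rintro _ ⟨Q, rfl⟩
  exact ciSup_le' fun hQ => edpOfElt_le hp L hQ

/-- Let `k` be a field, `p` a prime, `A` a finite-dimensional associative unital
`k`-algebra, `r ≥ 0` a rational number, and `l/k` a finite field extension of degree prime
to `p`.  Then the essential `p`-dimension of the functor `Mod_{A,r}` on field extensions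
of `k` equals the essential `p`-dimension of the functor `Mod_{A ⊗_k l, r}` on field
extensions of `l`. -/
theorem edp_eq_of_prime_to_p_extension (k : Type u) [Field k] (p : ℕ) (hp : p.Prime)
    (A : Type u) [Ring A] [Algebra k A] [FiniteDimensional k A] (r : ℚ) (hr : 0 ≤ r)
    (l : Type u) [Field l] [Algebra k l] [FiniteDimensional k l]
    (hl : ¬ p ∣ Module.finrank k l) :
    edpFunctor k A r p = edpFunctor l (A ⊗[k] l) r p := by
  refine Cardinal.iSup_eq_iSup_of_forall_exists_le ?_ ?_
  · rintro ⟨L⟩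
    obtain ⟨L', _, _, _, _, _, _, _, hL'⟩ := exists_compositum_not_dvd_finrank k l L p hl
    refine ⟨⟨L'⟩, ciSup_le' fun Q => ciSup_le' fun hQ => ?_⟩
    obtain ⟨Q', q, hq⟩ := exists_isBaseChangeAlong ((tensorTowerHom k A l L').toRingHom.comp
      (Algebra.TensorProduct.map (AlgHom.id k A) (IsScalarTower.toAlgHom k L L')).toRingHom) Q
    have hQ' := hq.isProjOfRank hQ
    exact (edpOfElt_le_tensor hp L L' hL' hQ' hq).trans (edpOfElt_le_iSup hp ⟨L'⟩ hQ')
  · rintro ⟨L⟩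
    let : Algebra k L := Algebra.compHom L (algebraMap k l)
    have : IsScalarTower k l L := .of_algebraMap_eq fun _ => rfl
    refine ⟨⟨L⟩, ciSup_le' fun Q => ciSup_le' fun hQ => ?_⟩
    obtain ⟨Q₀, q, hq⟩ := exists_isBaseChangeAlong (tensorTowerInv k A l L) Q
    have hQ₀ := hq.isProjOfRank hQ
    exact (edpOfElt_tensor_le hp L hQ₀ hq).trans (edpOfElt_le_iSup hp ⟨L⟩ hQ₀)
end
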